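/- For every real T ≥ 3/2, the quantity B(T) = (2/3) tanh³(T) − sech²(T)·(2 tanh(T) − 2T sech²(T)) is positive, and ∫_{−T}^{T} (sech²(u) − sech²(T))² du ≤ Q(T) · ∫_{−T}^{T} (tanh(u) − u sech²(T))² sech²(u) du, where Q(T) = [(4/3) tanh³(T) − sech²(T)·(2 tanh(T) − 2T sech²(T))] / B(T) and sech(u) = 1/cosh(u). -/

import Mathlib

open Real MeasureTheory

theorem hasDerivAt_tanh_sech (u : ℝ) : HasDerivAt Real.tanh ((1 / Real.cosh u) ^ 2) u := by
  have hc : Real.cosh u ≠ 0 := (Real.cosh_pos u).ne'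
  have h := (Real.hasDerivAt_sinh u).div (Real.hasDerivAt_cosh u) hc
  have hfun : Real.tanh = Real.sinh / Real.cosh := by
    ext x
    simp [Real.tanh_eq_sinh_div_cosh]
  rw [hfun]
  refine h.congr_deriv ?_
  have := Real.cosh_sq u
  field_simp
  linarith

theorem hasDerivAt_sech_sq (u : ℝ) :
    HasDerivAt (fun u => (1 / Real.cosh u) ^ 2) (-2 * Real.tanh u * (1 / Real.cosh u) ^ 2) u := by
  have hc : Real.cosh u ≠ 0 := (Real.cosh_pos u).ne'
  have h := ((hasDerivAt_const u (1 : ℝ)).div (Real.hasDerivAt_cosh u) hc).pow 2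
  refine h.congr_deriv ?_
  rw [Real.tanh_eq_sinh_div_cosh]
  simp only [Pi.div_apply]
  norm_num
  field_simp

theorem sech_sq_eq_one_sub_tanh_sq (u : ℝ) : (1 / Real.cosh u) ^ 2 = 1 - Real.tanh u ^ 2 := by
  have hc : Real.cosh u ≠ 0 := (Real.cosh_pos u).ne'
  have := Real.cosh_sq u
  rw [Real.tanh_eq_sinh_div_cosh]
  field_simp
  linarith

theorem continuous_sech_sq : Continuous fun u : ℝ => (1 / Real.cosh u) ^ 2 :=
  continuous_iff_continuousAt.2 fun u => (hasDerivAt_sech_sq u).continuousAt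

theorem continuous_tanh_real : Continuous Real.tanh :=
  continuous_iff_continuousAt.2 fun u => (hasDerivAt_tanh_sech u).continuousAt

theorem integral_sech_sq_sub_sq (c T : ℝ) :
    ∫ u in (-T)..T, ((1 / Real.cosh u) ^ 2 - c) ^ 2
      = 2 * (Real.tanh T - Real.tanh T ^ 3 / 3 - 2 * c * Real.tanh T + c ^ 2 * T) := by
  have hd (u : ℝ) : HasDerivAt
      (fun u => Real.tanh u - Real.tanh u ^ 3 / 3 - 2 * c * Real.tanh u + c ^ 2 * u)
      (((1 / Real.cosh u) ^ 2 - c) ^ 2) u := by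
    have h := hasDerivAt_tanh_sech u
    refine ((((h.sub ((h.pow 3).div_const 3)).sub (h.const_mul (2 * c)))).add
      ((hasDerivAt_id u).const_mul (c ^ 2))).congr_deriv ?_
    rw [sech_sq_eq_one_sub_tanh_sq]
    push_cast
    ring
  rw [intervalIntegral.integral_eq_sub_of_hasDerivAt (fun u _ => hd u)
    (((continuous_sech_sq.sub continuous_const).pow 2).intervalIntegrable _ _)]
  rw [Real.tanh_neg]
  ring

theorem le_integral_tanh_sub_mul_sq_mul_sech_sq (c : ℝ) {T : ℝ} (hT : 0 ≤ T) :
    2 / 3 * Real.tanh T ^ 3 - c * (2 * Real.tanh T - 2 * T * (1 / Real.cosh T) ^ 2)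
      ≤ ∫ u in (-T)..T, (Real.tanh u - u * c) ^ 2 * (1 / Real.cosh u) ^ 2 := by
  have hd (u : ℝ) : HasDerivAt
      (fun u => Real.tanh u ^ 3 / 3 - c * (Real.tanh u - u * (1 / Real.cosh u) ^ 2))
      ((Real.tanh u ^ 2 - 2 * c * u * Real.tanh u) * (1 / Real.cosh u) ^ 2) u := by
    have h := hasDerivAt_tanh_sech u
    refine (((h.pow 3).div_const 3).sub
      ((h.sub ((hasDerivAt_id u).mul (hasDerivAt_sech_sq u))).const_mul c)).congr_deriv ?_
    push_cast
    simp only [id]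
    ring
  have ht := continuous_tanh_real
  have hs := continuous_sech_sq
  have hint : IntervalIntegrable
      (fun u => (Real.tanh u ^ 2 - 2 * c * u * Real.tanh u) * (1 / Real.cosh u) ^ 2)
      volume (-T) T :=
    (Continuous.mul (by fun_prop) hs).intervalIntegrable _ _
  calc
    _ = ∫ u in (-T)..T,
        (Real.tanh u ^ 2 - 2 * c * u * Real.tanh u) * (1 / Real.cosh u) ^ 2 := by
      rw [intervalIntegral.integral_eq_sub_of_hasDerivAt (fun u _ => hd u) hint,
        Real.tanh_neg, Real.cosh_neg]
      ring
    _ ≤ _ := by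
      refine intervalIntegral.integral_mono_on (by linarith) hint
        ((Continuous.mul (by fun_prop) hs).intervalIntegrable _ _) fun u _ => ?_
      refine mul_le_mul_of_nonneg_right ?_ (sq_nonneg _)
      nlinarith [sq_nonneg (u * c)]

theorem two_lt_cosh {T : ℝ} (hT : 3 / 2 ≤ T) : 2 < Real.cosh T := by
  have h1 : T / 2 ≤ Real.sinh (T / 2) := Real.self_le_sinh_iff.2 (by linarith)
  have h2 := Real.cosh_two_mul (T / 2)
  have h3 := Real.cosh_sq (T / 2)
  rw [mul_div_cancel₀ T two_ne_zero] at h2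
  nlinarith

/-- Key estimate of the final appendix lemma: for `T ≥ 3/2`, the quantity
`B(T) = (2/3) tanh³(T) - sech²(T)(2 tanh T - 2 T sech²(T))` is positive, and the Rayleigh
numerator `∫_{-T}^{T} (sech²(u) - sech²(T))² du` is at most
`Q(T) = [(4/3) tanh³(T) - sech²(T)(2 tanh T - 2 T sech²(T))] / B(T)` times the Rayleigh
denominator `∫_{-T}^{T} (tanh u - u sech²(T))² sech²(u) du`; here `sech u = 1 / cosh u`. -/
theorem stmt_10 (T : ℝ) (hT : 3/2 ≤ T) :
    0 < (2/3) * (Real.tanh T)^3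
        - (1 / Real.cosh T)^2 * (2 * Real.tanh T - 2 * T * (1 / Real.cosh T)^2)
    ∧ ∫ u in (-T)..T, ((1 / Real.cosh u)^2 - (1 / Real.cosh T)^2)^2
        ≤ (((4/3) * (Real.tanh T)^3
              - (1 / Real.cosh T)^2 * (2 * Real.tanh T - 2 * T * (1 / Real.cosh T)^2))
            / ((2/3) * (Real.tanh T)^3
              - (1 / Real.cosh T)^2 * (2 * Real.tanh T - 2 * T * (1 / Real.cosh T)^2)))
          * ∫ u in (-T)..T,
              (Real.tanh u - u * (1 / Real.cosh T)^2)^2 * (1 / Real.cosh u)^2 := by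
  have hT0 : 0 < T := by linarith
  have hcosh := two_lt_cosh hT
  have hden := le_integral_tanh_sub_mul_sq_mul_sech_sq ((1 / Real.cosh T) ^ 2) hT0.le
  have hnum := integral_sech_sq_sub_sq ((1 / Real.cosh T) ^ 2) T
  have hnum_nonneg : 0 ≤ ∫ u in (-T)..T, ((1 / Real.cosh u) ^ 2 - (1 / Real.cosh T) ^ 2) ^ 2 :=
    intervalIntegral.integral_nonneg (by linarith) fun u _ => sq_nonneg _
  have hsech := sech_sq_eq_one_sub_tanh_sq T
  have hsech_lt : (1 / Real.cosh T) ^ 2 < 1 / 4 := by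
    rw [div_pow, one_pow]
    exact one_div_lt_one_div_of_lt (by norm_num) (by nlinarith)
  have htanh : 0 < Real.tanh T := by
    rw [Real.tanh_eq_sinh_div_cosh]
    exact div_pos (Real.sinh_pos_iff.2 hT0) (Real.cosh_pos T)
  have hpos : 0 < (2/3) * (Real.tanh T)^3
      - (1 / Real.cosh T)^2 * (2 * Real.tanh T - 2 * T * (1 / Real.cosh T)^2) := by
    have h1 : 0 < Real.tanh T * (2 / 3 - 8 / 3 * (1 / Real.cosh T) ^ 2) :=
      mul_pos htanh (by linarith)
    have h2 : 0 ≤ T * ((1 / Real.cosh T) ^ 2) ^ 2 := by positivity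
    have h3 : Real.tanh T ^ 3 = Real.tanh T * (1 - (1 / Real.cosh T) ^ 2) := by
      rw [hsech]; ring
    rw [h3]
    linarith
  have hnum_eq : ∫ u in (-T)..T, ((1 / Real.cosh u) ^ 2 - (1 / Real.cosh T) ^ 2) ^ 2
      = (4/3) * (Real.tanh T)^3
        - (1 / Real.cosh T)^2 * (2 * Real.tanh T - 2 * T * (1 / Real.cosh T)^2) := by
    rw [hnum, hsech]
    ring
  refine ⟨hpos, ?_⟩
  rw [hnum_eq] at hnum_nonneg ⊢
  exact ((le_div_iff₀ hpos).2 (mul_le_mul_of_nonneg_left hden hnum_nonneg)).trans_eq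
    (div_mul_eq_mul_div _ _ _).symm
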